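/- Let u ∈ ℤ_p^× with −u ∉ Nm_{H/ℚ_p}(H^×), and let T_1 be the 2×2 diagonal matrix diag(1, u). If g ∈ GL_2(H) satisfies ᵗ(ḡ)·T_1·g = T_1 (where ḡ is the entrywise Galois conjugate of g), then all entries of g lie in O_H and det(g) ∈ O_H^×; that is, g ∈ GL_2(O_H). -/

import Mathlib

/- Common setup: ramified quadratic extension H/ℚ_p, ring of integers O_H,
   hermitian forms, lattices, duals, vertex lattices. -/

open scoped Classical

noncomputable section

namespace Ramified

/-- The ring of integers of `H`: the integral closure of `ℤ_p` in `H`. -/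
def OH (p : ℕ) [Fact (Nat.Prime p)] (H : Type) [Field H] [Algebra ℚ_[p] H] : Subring H :=
  letI : Algebra ℤ_[p] H := ((algebraMap ℚ_[p] H).comp PadicInt.Coe.ringHom).toAlgebra
  (integralClosure ℤ_[p] H).toSubring

/-- `H/ℚ_p` is a ramified quadratic extension with nontrivial Galois automorphism `conj`
and uniformizer `ϖ` satisfying `conj ϖ = -ϖ` and `ϖ² = π₀` a uniformizer of `ℤ_p`. -/
structure IsRamifiedQuadratic (p : ℕ) [Fact (Nat.Prime p)] (H : Type) [Field H]
    [Algebra ℚ_[p] H] (conj : H ≃+* H) (ϖ : H) : Prop where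
  conj_conj : ∀ x : H, conj (conj x) = x
  conj_fix : ∀ q : ℚ_[p], conj (algebraMap ℚ_[p] H q) = algebraMap ℚ_[p] H q
  conj_ne : conj ≠ RingEquiv.refl H
  dim_two : Module.finrank ℚ_[p] H = 2
  conj_unif : conj ϖ = -ϖ
  unif_sq : ∃ u : ℤ_[p]ˣ, ϖ * ϖ = algebraMap ℚ_[p] H ((u : ℤ_[p]) : ℚ_[p]) * (p : H)

variable {p : ℕ} [Fact (Nat.Prime p)] {H : Type} [Field H] [Algebra ℚ_[p] H]

/-- Any `H`-module is an `O_H`-module by restriction of scalars. -/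
instance moduleOH (C : Type) [AddCommGroup C] [Module H C] : Module (OH p H) C :=
  Module.compHom C (OH p H).subtype

variable {C : Type} [AddCommGroup C] [Module H C]

theorem oh_smul_def (c : OH p H) (x : C) : c • x = (c : H) • x := rfl

/-- A hermitian form on `C` with respect to the conjugation `conj` of `H`:
linear in the first variable, conjugate-symmetric. -/
structure HermForm (H : Type) [Field H] (C : Type) [AddCommGroup C] [Module H C]
    (conj : H ≃+* H) where
  form : C → C → H
  form_add : ∀ x y z : C, form (x + y) z = form x z + form y z
  form_smul : ∀ (a : H) (x y : C), form (a • x) y = a * form x y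
  form_conj : ∀ x y : C, form y x = conj (form x y)

variable {conj : H ≃+* H}

theorem HermForm.form_zero (φ : HermForm H C conj) (y : C) : φ.form 0 y = 0 := by
  have h := φ.form_smul (0 : H) 0 y
  simpa using h

/-- The dual lattice `Λ♯ = {x : C | φ(x, Λ) ⊆ O_H}`. -/
def HermForm.dual (φ : HermForm H C conj) (Λ : Submodule (OH p H) C) :
    Submodule (OH p H) C where
  carrier := {x : C | ∀ y ∈ Λ, φ.form x y ∈ OH p H}
  add_mem' := by
    intro a b ha hb y hy
    rw [φ.form_add]
    exact add_mem (ha y hy) (hb y hy)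
  zero_mem' := by
    intro y hy
    rw [HermForm.form_zero]
    exact zero_mem _
  smul_mem' := by
    intro c x hx y hy
    show φ.form ((c : H) • x) y ∈ OH p H
    rw [φ.form_smul]
    exact mul_mem c.2 (hx y hy)

/-- The orthogonal complement (in `C = L ⊗ H`) of a sublattice. -/
def HermForm.orthog (φ : HermForm H C conj) (N : Submodule (OH p H) C) :
    Submodule (OH p H) C where
  carrier := {x : C | ∀ y ∈ N, φ.form x y = 0}
  add_mem' := by
    intro a b ha hb y hy
    rw [φ.form_add, ha y hy, hb y hy, add_zero]
  zero_mem' := by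
    intro y hy
    rw [HermForm.form_zero]
  smul_mem' := by
    intro c x hx y hy
    show φ.form ((c : H) • x) y = 0
    rw [φ.form_smul, hx y hy, mul_zero]

/-- Scalar multiplication by `a : H`, as an `O_H`-linear map. -/
def smulMap (a : H) : C →ₗ[OH p H] C where
  toFun x := a • x
  map_add' x y := smul_add a x y
  map_smul' c x := by
    show a • ((c : H) • x) = (c : H) • (a • x)
    rw [smul_comm]

/-- The lattice `a • Λ` for a scalar `a : H`. -/
def scale (a : H) (Λ : Submodule (OH p H) C) : Submodule (OH p H) C :=
  Λ.map (smulMap a)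

/-- An `H`-subspace of `C`, viewed as an `O_H`-submodule. -/
def restrictOH (W : Submodule H C) : Submodule (OH p H) C where
  carrier := (W : Set C)
  add_mem' := fun ha hb => W.add_mem ha hb
  zero_mem' := W.zero_mem
  smul_mem' := fun c x hx => W.smul_mem (c : H) hx

/-- The cardinality of the quotient `Λ/N` (for `N ⊆ Λ` this is the usual quotient). -/
def quotCard (N Λ : Submodule (OH p H) C) : ℕ :=
  Nat.card (Λ ⧸ N.comap Λ.subtype)

/-- A (full) `O_H`-lattice in `C`: finitely generated and spanning `C` over `H`. -/
def IsLattice (Λ : Submodule (OH p H) C) : Prop :=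
  Λ.FG ∧ Submodule.span H (Λ : Set C) = ⊤

/-- A vertex lattice: a full lattice with `ϖΛ ⊆ Λ♯ ⊆ Λ`. -/
def IsVertexLattice (φ : HermForm H C conj) (ϖ : H) (Λ : Submodule (OH p H) C) : Prop :=
  IsLattice Λ ∧ scale ϖ Λ ≤ φ.dual Λ ∧ φ.dual Λ ≤ Λ

/-- `Λ ∈ Vert(L)`: a vertex lattice with `L ⊆ Λ♯`. -/
def InVert (φ : HermForm H C conj) (ϖ : H) (L Λ : Submodule (OH p H) C) : Prop :=
  IsVertexLattice φ ϖ Λ ∧ L ≤ φ.dual Λ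

/-- `M` is `a`-modular (e.g. `a = ϖ^i`): `(x, M) = a·O_H` for every maximal `x ∈ M`. -/
def IsPiModular (φ : HermForm H C conj) (ϖ a : H) (M : Submodule (OH p H) C) : Prop :=
  ∀ x ∈ M, x ∉ scale ϖ M →
    (fun y => φ.form x y) '' (M : Set C) = (fun c => a * c) '' ((OH p H : Set H))

/-- `N` is split: an orthogonal direct sum of hyperbolic planes `H(i)`. -/
def IsSplitLat (φ : HermForm H C conj) (ϖ : H) (N : Submodule (OH p H) C) : Prop :=
  ∃ (s : ℕ) (e f : Fin s → C) (d : Fin s → ℕ),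
    N = Submodule.span (OH p H) (Set.range e ∪ Set.range f) ∧
    (∀ j, φ.form (e j) (e j) = 0 ∧ φ.form (f j) (f j) = 0 ∧
      φ.form (e j) (f j) = ϖ ^ d j) ∧
    ∀ j j', j ≠ j' → φ.form (e j) (e j') = 0 ∧ φ.form (e j) (f j') = 0 ∧
      φ.form (f j) (e j') = 0 ∧ φ.form (f j) (f j') = 0

/-- The `O_H`-rank of a sublattice of `C` (the dimension of the subspace it spans). -/
def rk (N : Submodule (OH p H) C) : ℕ :=
  Module.finrank H (Submodule.span H (N : Set C))

/-- A Jordan splitting `L = ⊕_{0 ≤ λ ≤ k} L_λ` with `L_λ` being `ϖ^λ`-modular (or zero). -/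
structure JordanSplitting (φ : HermForm H C conj) (ϖ : H) (L : Submodule (OH p H) C)
    (k : ℕ) (Lc : ℕ → Submodule (OH p H) C) : Prop where
  sup_eq : L = ⨆ i ∈ Finset.range (k + 1), Lc i
  bot_of_gt : ∀ i, k < i → Lc i = ⊥
  disj : ∀ i ∈ Finset.range (k + 1),
    Disjoint (Lc i) (⨆ j ∈ (Finset.range (k + 1)).erase i, Lc j)
  orthog : ∀ i j, i ≠ j → ∀ x ∈ Lc i, ∀ y ∈ Lc j, φ.form x y = 0
  modular : ∀ i ∈ Finset.range (k + 1), Lc i ≠ ⊥ → IsPiModular φ ϖ (ϖ ^ i) (Lc i)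

/-- `L_{≥ t} = ⊕_{λ ≥ t} L_λ`. -/
def Lge (Lc : ℕ → Submodule (OH p H) C) (k t : ℕ) : Submodule (OH p H) C :=
  ⨆ i ∈ Finset.Icc t k, Lc i

/-- `m(L) = rank_{O_H} L_{≥1}`. -/
def mOf (Lc : ℕ → Submodule (OH p H) C) (k : ℕ) : ℕ :=
  ∑ i ∈ Finset.Icc 1 k, rk (Lc i)

/-- The invariant `t(L)` from Theorem A. -/
def tOf (φ : HermForm H C conj) (ϖ : H) (Lc : ℕ → Submodule (OH p H) C) (k : ℕ) : ℕ :=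
  if Odd (mOf Lc k) then mOf Lc k - 1
  else if IsSplitLat φ ϖ (Lge Lc k 1) then mOf Lc k
  else mOf Lc k - 2

/-- `n_odd = Σ_{λ ≥ 3, λ odd} rank L_λ`. -/
def nOdd (Lc : ℕ → Submodule (OH p H) C) (k : ℕ) : ℕ :=
  ∑ i ∈ (Finset.Icc 3 k).filter (fun i => Odd i), rk (Lc i)

/-- `n_even = Σ_{λ ≥ 2, λ even} rank L_λ`. -/
def nEven (Lc : ℕ → Submodule (OH p H) C) (k : ℕ) : ℕ :=
  ∑ i ∈ (Finset.Icc 2 k).filter (fun i => Even i), rk (Lc i)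

end Ramified

namespace Ramified

theorem norm_sq_le_norm_sub_mul_sq {p : ℕ} [Fact p.Prime] {c : ℚ_[p]}
    (hc : ‖c‖ = (p : ℝ)⁻¹) (s t : ℚ_[p]) : ‖s‖ ^ 2 ≤ ‖s ^ 2 - c * t ^ 2‖ := by
  have hne : s ≠ 0 → ‖s ^ 2‖ ≠ ‖-(c * t ^ 2)‖ := by
    intro hs h
    rw [norm_neg, norm_mul, norm_pow, norm_pow, hc] at h
    have hp1 : (1 : ℝ) < p := mod_cast (Fact.out : p.Prime).one_lt
    have ht : t ≠ 0 := by
      rintro rfl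
      simp [hs] at h
    rw [Padic.norm_eq_zpow_neg_valuation hs, Padic.norm_eq_zpow_neg_valuation ht, ← zpow_natCast,
      ← zpow_natCast, ← zpow_mul, ← zpow_mul, ← zpow_neg_one, ← zpow_add₀ (by positivity)] at h
    have := zpow_right_injective₀ (by positivity) hp1.ne' h
    push_cast at this
    omega
  by_cases hs : s = 0
  · rw [hs, norm_zero, zero_pow two_ne_zero]
    exact norm_nonneg _
  · rw [sub_eq_add_neg, Padic.add_eq_max_of_ne (hne hs), norm_pow]
    exact le_max_left _ _

theorem exists_sq_eq_of_norm_sub_one_lt {p : ℕ} [Fact p.Prime] (hp : p ≠ 2) {a : ℚ_[p]}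
    (ha : ‖a - 1‖ < 1) : ∃ w : ℚ_[p], w ^ 2 = a := by
  have h2 : ‖(2 : ℤ_[p])‖ = 1 := by
    have := PadicInt.norm_natCast_eq_one_iff (p := p) (n := 2)
    push_cast at this
    rw [this]
    exact (Nat.coprime_primes Fact.out Nat.prime_two).2 hp
  have hb : ‖a‖ ≤ 1 := by
    have := Padic.nonarchimedean (a - 1) 1
    rw [sub_add_cancel, norm_one] at this
    exact this.trans (max_le ha.le le_rfl)
  let b : ℤ_[p] := ⟨a, hb⟩
  have hb1 : ‖b - 1‖ < 1 := ha
  obtain ⟨z, hz, -⟩ := hensels_lemma (p := p) (R := ℤ_[p])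
    (F := Polynomial.X ^ 2 - Polynomial.C b) (a := 1) (by
      simpa [h2, one_add_one_eq_two, norm_sub_rev] using hb1)
  refine ⟨z, ?_⟩
  have hz' : z ^ 2 = b := by simpa [sub_eq_zero] using hz
  have := congrArg (fun x : ℤ_[p] => (x : ℚ_[p])) hz'
  simpa [b] using this

theorem mem_OH_of_quadratic {p : ℕ} [Fact p.Prime] {H : Type} [Field H] [Algebra ℚ_[p] H]
    {x : H} {a b : ℚ_[p]} (ha : ‖a‖ ≤ 1) (hb : ‖b‖ ≤ 1)
    (h : x ^ 2 - algebraMap ℚ_[p] H a * x + algebraMap ℚ_[p] H b = 0) : x ∈ OH p H := by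
  let : Algebra ℤ_[p] H := ((algebraMap ℚ_[p] H).comp PadicInt.Coe.ringHom).toAlgebra
  let A : ℤ_[p] := ⟨a, ha⟩
  let B : ℤ_[p] := ⟨b, hb⟩
  change IsIntegral ℤ_[p] x
  refine ⟨Polynomial.X ^ 2 - Polynomial.C A * Polynomial.X
    + Polynomial.C B, by monicity!, ?_⟩
  simp only [Polynomial.eval₂_add, Polynomial.eval₂_sub, Polynomial.eval₂_mul,
    Polynomial.eval₂_pow, Polynomial.eval₂_X, Polynomial.eval₂_C]
  exact h

namespace IsRamifiedQuadratic

variable {p : ℕ} [Fact p.Prime] {H : Type} [Field H] [Algebra ℚ_[p] H] {conj : H ≃+* H} {ϖ : H}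

theorem unif_ne_zero (hram : IsRamifiedQuadratic p H conj ϖ) : ϖ ≠ 0 := by
  rintro rfl
  obtain ⟨u, hu⟩ := hram.unif_sq
  have hp0 : (p : H) ≠ 0 := by
    rw [← map_natCast (algebraMap ℚ_[p] H), map_ne_zero, Nat.cast_ne_zero]
    exact (Fact.out : p.Prime).ne_zero
  have hu0 : algebraMap ℚ_[p] H ((u : ℤ_[p]) : ℚ_[p]) ≠ 0 := by simp
  simp [hp0, hu0] at hu

theorem exists_eq_add_mul_unif (hram : IsRamifiedQuadratic p H conj ϖ) (x : H) :
    ∃ s t : ℚ_[p], x = algebraMap ℚ_[p] H s + algebraMap ℚ_[p] H t * ϖ := by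
  have hϖ := hram.unif_ne_zero
  have : CharZero H := charZero_of_injective_algebraMap (algebraMap ℚ_[p] H).injective
  have hli : LinearIndependent ℚ_[p] ![(1 : H), ϖ] := by
    rw [LinearIndependent.pair_iff]
    intro a b hab
    rw [Algebra.smul_def, Algebra.smul_def, mul_one] at hab
    have hab' := congrArg conj hab
    rw [map_add, map_mul, hram.conj_fix, hram.conj_fix, hram.conj_unif, map_zero] at hab'
    have ha : algebraMap ℚ_[p] H a = 0 := by
      have : 2 * algebraMap ℚ_[p] H a = 0 := by linear_combination hab + hab'
      simpa using this
    rw [ha, zero_add] at hab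
    exact ⟨by simpa using ha, by simpa [hϖ] using hab⟩
  have htop := hli.span_eq_top_of_card_eq_finrank (by simp [hram.dim_two])
  have hx : x ∈ Submodule.span ℚ_[p] (Set.range ![(1 : H), ϖ]) := htop ▸ Submodule.mem_top
  rw [Matrix.range_cons_cons_empty, Submodule.mem_span_pair] at hx
  obtain ⟨s, t, h⟩ := hx
  exact ⟨s, t, by rw [← h, Algebra.smul_def, Algebra.smul_def, mul_one]⟩

/-- The norm `x * conj x` lies in `ℚ_p`, and its integrality detects that of `x`. -/
theorem exists_norm (hram : IsRamifiedQuadratic p H conj ϖ) (x : H) :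
    ∃ n : ℚ_[p], x * conj x = algebraMap ℚ_[p] H n ∧ (‖n‖ ≤ 1 → x ∈ OH p H) := by
  obtain ⟨s, t, rfl⟩ := hram.exists_eq_add_mul_unif x
  obtain ⟨u, hu⟩ := hram.unif_sq
  rw [← map_natCast (algebraMap ℚ_[p] H), ← map_mul] at hu
  have hc : ‖((u : ℤ_[p]) : ℚ_[p]) * (p : ℚ_[p])‖ = (p : ℝ)⁻¹ := by
    rw [norm_mul, ← PadicInt.norm_def, PadicInt.norm_units, one_mul, Padic.norm_p]
  generalize ((u : ℤ_[p]) : ℚ_[p]) * (p : ℚ_[p]) = c at hu hc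
  refine ⟨s ^ 2 - c * t ^ 2, ?_, fun hn => ?_⟩
  · simp only [map_add, map_mul, map_sub, map_pow, hram.conj_fix, hram.conj_unif]
    linear_combination -(algebraMap ℚ_[p] H t) ^ 2 * hu
  · have hs : ‖s‖ ≤ 1 := by
      have := (norm_sq_le_norm_sub_mul_sq hc s t).trans hn
      exact (sq_le_one_iff₀ (norm_nonneg _)).1 this
    have h2 : ‖(2 : ℚ_[p])‖ ≤ 1 := by simpa using Padic.norm_int_le_one (p := p) 2
    refine mem_OH_of_quadratic (a := 2 * s) (b := s ^ 2 - c * t ^ 2) ?_ hn ?_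
    · rw [norm_mul]
      exact mul_le_one₀ h2 (norm_nonneg _) hs
    · simp only [map_mul, map_sub, map_pow, map_ofNat]
      linear_combination (algebraMap ℚ_[p] H t) ^ 2 * hu

/-- The anisotropic hermitian form `diag(1, u)` takes integral values only at integral vectors. -/
theorem mem_OH_of_norm_add_mul_norm (hp : p ≠ 2) (hram : IsRamifiedQuadratic p H conj ϖ)
    {u : ℤ_[p]ˣ}
    (hu : ∀ y : H, y ≠ 0 →
      y * conj y ≠ -(algebraMap ℚ_[p] H ((u : ℤ_[p]) : ℚ_[p])))
    {x y : H} {m : ℚ_[p]} (hm : ‖m‖ ≤ 1)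
    (h : x * conj x + algebraMap ℚ_[p] H ((u : ℤ_[p]) : ℚ_[p]) * (y * conj y)
      = algebraMap ℚ_[p] H m) : x ∈ OH p H ∧ y ∈ OH p H := by
  obtain ⟨a, ha, hx⟩ := hram.exists_norm x
  obtain ⟨b, hb, hy⟩ := hram.exists_norm y
  have hu1 : ‖((u : ℤ_[p]) : ℚ_[p])‖ = 1 := PadicInt.norm_units u
  generalize ((u : ℤ_[p]) : ℚ_[p]) = v at *
  rw [ha, hb, ← map_mul, ← map_add] at h
  have hab : a = m - v * b := eq_sub_of_add_eq ((algebraMap ℚ_[p] H).injective h)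
  have hb1 : ‖b‖ ≤ 1 := by
    by_contra! hb1
    have hb0 : b ≠ 0 := by
      rintro rfl
      simp at hb1
      linarith
    have hv0 : v ≠ 0 := by
      rintro rfl
      simp at hu1
    have hy0 : y ≠ 0 := by
      rintro rfl
      exact hb0 (by simpa using hb.symm)
    obtain ⟨w, hw⟩ := exists_sq_eq_of_norm_sub_one_lt hp (a := 1 - m / (v * b)) (by
      rw [sub_sub_cancel_left, norm_neg, norm_div, norm_mul, hu1, one_mul,
        div_lt_one (by positivity)]
      exact hm.trans_lt hb1)
    have hwb : a = -v * b * w ^ 2 := by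
      rw [hw, hab]
      field_simp
      ring
    have hw0 : w ≠ 0 := by
      rintro rfl
      have h1 : m / (v * b) = 1 := by linear_combination hw
      rw [div_eq_one_iff_eq (mul_ne_zero hv0 hb0)] at h1
      rw [h1, norm_mul, hu1, one_mul] at hm
      linarith
    have hx0 : x ≠ 0 := by
      rintro rfl
      have ha0 : a = 0 := by simpa using ha.symm
      rw [ha0] at hwb
      simp [hv0, hb0, hw0] at hwb
    have hW0 : algebraMap ℚ_[p] H w ≠ 0 := by simpa using hw0
    refine hu (x / (y * algebraMap ℚ_[p] H w)) (div_ne_zero hx0 (mul_ne_zero hy0 hW0)) ?_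
    have hcy : conj y ≠ 0 := by simpa using hy0
    rw [map_div₀, map_mul, hram.conj_fix, div_mul_div_comm, div_eq_iff (by positivity), ha, hwb]
    simp only [map_mul, map_neg, map_pow, ← hb]
    ring
  refine ⟨hx ?_, hy hb1⟩
  rw [hab, sub_eq_add_neg]
  refine (Padic.nonarchimedean _ _).trans (max_le hm ?_)
  rwa [norm_neg, norm_mul, hu1, one_mul]

theorem mem_OH_of_norm_eq_one (hram : IsRamifiedQuadratic p H conj ϖ) {x : H}
    (hx : x * conj x = 1) : x ∈ OH p H := by
  obtain ⟨n, hn, h⟩ := hram.exists_norm x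
  refine h ?_
  rw [hx, ← map_one (algebraMap ℚ_[p] H)] at hn
  rw [← (algebraMap ℚ_[p] H).injective hn, norm_one]

end IsRamifiedQuadratic

open Matrix in
/-- Let `u ∈ ℤ_p^×` with `-u ∉ Nm_{H/ℚ_p}(H^×)` and
`T₁ = diag(1, u)`. If `g ∈ GL₂(H)` satisfies `ᵗ(ḡ)·T₁·g = T₁`, then all entries of `g`
lie in `O_H` and `det g ∈ O_H^×`; that is, `g ∈ GL₂(O_H)`. -/
theorem statement_14 (p : ℕ) [Fact (Nat.Prime p)] (hp : p ≠ 2)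
    (H : Type) [Field H] [Algebra ℚ_[p] H] (conj : H ≃+* H) (ϖ : H)
    (hram : IsRamifiedQuadratic p H conj ϖ)
    (u : ℤ_[p]ˣ)
    (hu : ∀ y : H, y ≠ 0 →
      y * conj y ≠ -(algebraMap ℚ_[p] H ((u : ℤ_[p]) : ℚ_[p])))
    (g : Matrix (Fin 2) (Fin 2) H)
    (hdet : g.det ≠ 0)
    (hg : (g.map conj)ᵀ * Matrix.diagonal ![1, algebraMap ℚ_[p] H ((u : ℤ_[p]) : ℚ_[p])] * g
        = Matrix.diagonal ![1, algebraMap ℚ_[p] H ((u : ℤ_[p]) : ℚ_[p])]) :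
    (∀ i j, g i j ∈ OH p H) ∧ g.det ∈ OH p H ∧ (g.det)⁻¹ ∈ OH p H := by
  have hu1 : ‖((u : ℤ_[p]) : ℚ_[p])‖ = 1 := PadicInt.norm_units u
  have hU0 : algebraMap ℚ_[p] H ((u : ℤ_[p]) : ℚ_[p]) ≠ 0 := by simp
  have h00 := congrFun (congrFun hg 0) 0
  have h11 := congrFun (congrFun hg 1) 1
  simp [Matrix.mul_apply, Fin.sum_univ_two] at h00 h11
  have c0 := hram.mem_OH_of_norm_add_mul_norm hp hu (x := g 0 0) (y := g 1 0) (m := 1)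
    (by simp) (by rw [map_one]; linear_combination h00)
  have c1 := hram.mem_OH_of_norm_add_mul_norm hp hu (x := g 0 1) (y := g 1 1) hu1.le
    (by linear_combination h11)
  have hN : g.det * conj g.det = 1 := by
    have hd := congrArg Matrix.det hg
    have hc : (g.map conj).det = conj g.det := (RingEquiv.map_det conj g).symm
    rw [Matrix.det_mul, Matrix.det_mul, Matrix.det_transpose, hc] at hd
    simp only [Matrix.det_diagonal, Fin.prod_univ_two, Matrix.cons_val_zero,
      Matrix.cons_val_one, one_mul] at hd
    exact mul_left_cancel₀ hU0 (by linear_combination hd)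
  refine ⟨?_, hram.mem_OH_of_norm_eq_one hN, ?_⟩
  · intro i j
    fin_cases i <;> fin_cases j
    exacts [c0.1, c1.1, c0.2, c1.2]
  · rw [inv_eq_of_mul_eq_one_right hN]
    exact hram.mem_OH_of_norm_eq_one (by rw [hram.conj_conj, mul_comm, hN])

end Ramified
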